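/- For every m > 1, the balanced Barnes-Wall lattice is the m-fold tensor power of the 2-dimensional one: under the identification ℝ^{2^m} = ℝ^{2^{m-1}} ⊗ ℝ², compatible with indexing the coordinates by 𝔽₂^m = 𝔽₂^{m-1} × 𝔽₂, one has M_m = M_{m-1} ⊗_{ℤ[√2]} M_1; that is, M_m equals the ℤ[√2]-span of the set of elementary tensors u ⊗ w with u ∈ M_{m-1} and w ∈ M_1. Consequently M_m equals the ℤ[√2]-span of the elementary tensors v_1 ⊗ ⋯ ⊗ v_m with each v_i ∈ M_1, under ℝ^{2^m} = (ℝ²)^{⊗m}. -/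

import Mathlib

open Matrix

noncomputable section

abbrev V (m : ℕ) : Type := Fin m → ZMod 2

/-- The ring `ℤ[√2]`, as a subring of `ℝ`. -/
def Rsq2 : Subring ℝ := Subring.closure {Real.sqrt 2}

open scoped Classical in
/-- The generating vectors `2^{⌊(m-d+δ)/2⌋} χ_U`, where `U = a + W` runs over the affine
subspaces of `𝔽₂^m` of dimension `d`, `0 ≤ d ≤ m`, and `χ_U` is the characteristic vector
of `U` with respect to the orthonormal basis indexed by `𝔽₂^m`. -/
def BWgen (δ m : ℕ) : Set (V m → ℝ) :=
  {x | ∃ (d : ℕ) (W : Submodule (ZMod 2) (V m)) (a : V m), d ≤ m ∧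
    Module.finrank (ZMod 2) W = d ∧
    x = fun v => if v - a ∈ W then (2 : ℝ) ^ ((m - d + δ) / 2) else 0}

/-- The Barnes-Wall lattice `L_m` (δ = 1). -/
def BWL (m : ℕ) : Submodule ℤ (V m → ℝ) := Submodule.span ℤ (BWgen 1 m)

/-- The Barnes-Wall lattice `L'_m` (δ = 0). -/
def BWL' (m : ℕ) : Submodule ℤ (V m → ℝ) := Submodule.span ℤ (BWgen 0 m)

/-- The balanced Barnes-Wall lattice `M_m = √2·L'_m + L_m`, as a `ℤ[√2]`-submodule of
`ℝ^{2^m}`. -/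
def balancedBW (m : ℕ) : Submodule Rsq2 (V m → ℝ) :=
  Submodule.span Rsq2 ((fun x => Real.sqrt 2 • x) '' (BWL' m : Set (V m → ℝ)) ∪
    (BWL m : Set (V m → ℝ)))

/-- The element `√2` of `ℤ[√2]`. -/
def rt2 : Rsq2 := ⟨Real.sqrt 2, Subring.subset_closure rfl⟩

lemma rt2_smul_apply {m : ℕ} (x : V m → ℝ) (v : V m) : (rt2 • x) v = Real.sqrt 2 * x v := rfl

lemma sqrt_two_mul_self : Real.sqrt 2 * Real.sqrt 2 = 2 := Real.mul_self_sqrt (by norm_num)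

open scoped Classical in
/-- The vector `√2^{m-d} χ_{a+W}`, where `d = dim W`. -/
def scaledInd {m : ℕ} (W : Submodule (ZMod 2) (V m)) (a : V m) : V m → ℝ :=
  fun v => if v - a ∈ W then Real.sqrt 2 ^ (m - Module.finrank (ZMod 2) W) else 0

lemma finrank_le {m : ℕ} (W : Submodule (ZMod 2) (V m)) : Module.finrank (ZMod 2) W ≤ m := by
  simpa using Submodule.finrank_le W

/-- The balanced Barnes-Wall lattice is spanned by the vectors `√2^{m-d} χ_U`. -/
lemma balancedBW_eq_span (m : ℕ) :
    balancedBW m = Submodule.span Rsq2 {x | ∃ W a, x = scaledInd (m := m) W a} := by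
  have rt2_pow (k : ℕ) : Real.sqrt 2 ^ (2 * k) = 2 ^ k := by
    rw [pow_mul, sq, sqrt_two_mul_self]
  apply le_antisymm
  · set S := Submodule.span Rsq2 {x | ∃ W a, x = scaledInd (m := m) W a}
    have hmem (W : Submodule (ZMod 2) (V m)) (a : V m) : scaledInd W a ∈ S :=
      Submodule.subset_span ⟨W, a, rfl⟩
    refine Submodule.span_le.2 (Set.union_subset ?_ ?_)
    · rintro _ ⟨y, hy, rfl⟩
      change rt2 • y ∈ S
      induction hy using Submodule.span_induction with
      | zero => simp
      | add x y _ _ hx hy => rw [smul_add]; exact S.add_mem hx hy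
      | smul c x _ hx => rw [smul_comm]; exact S.toAddSubgroup.zsmul_mem hx c
      | mem x hx =>
        obtain ⟨d, W, a, hd, rfl, rfl⟩ := hx
        obtain ⟨k, hk | hk⟩ := Nat.even_or_odd' (m - Module.finrank (ZMod 2) W)
        · convert S.smul_mem rt2 (hmem W a) using 1
          ext v
          have : (2 * k + 0) / 2 = k := by omega
          simp only [rt2_smul_apply, scaledInd, hk, this, rt2_pow]
        · convert hmem W a using 1
          ext v
          have : (2 * k + 1 + 0) / 2 = k := by omega
          simp only [rt2_smul_apply, scaledInd, hk, this, pow_succ]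
          split_ifs
          · rw [rt2_pow, mul_comm]
          · simp
    · intro y hy
      change y ∈ S
      induction hy using Submodule.span_induction with
      | zero => simp
      | add x y _ _ hx hy => exact S.add_mem hx hy
      | smul c x _ hx => exact S.toAddSubgroup.zsmul_mem hx c
      | mem x hx =>
        obtain ⟨d, W, a, hd, rfl, rfl⟩ := hx
        obtain ⟨k, hk | hk⟩ := Nat.even_or_odd' (m - Module.finrank (ZMod 2) W)
        · convert hmem W a using 1
          ext v
          have : (2 * k + 1) / 2 = k := by omega
          simp only [scaledInd, hk, this, rt2_pow]
        · convert S.smul_mem rt2 (hmem W a) using 1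
          ext v
          have : (2 * k + 1 + 1) / 2 = k + 1 := by omega
          simp only [rt2_smul_apply, scaledInd, hk, this, mul_ite, mul_zero]
          rw [← pow_succ', ← rt2_pow, mul_add_one]
  · refine Submodule.span_le.2 ?_
    rintro _ ⟨W, a, rfl⟩
    have hW := finrank_le W
    obtain ⟨k, hk | hk⟩ := Nat.even_or_odd' (m - Module.finrank (ZMod 2) W)
    · refine Submodule.subset_span (Or.inr (Submodule.subset_span ⟨_, W, a, hW, rfl, ?_⟩))
      ext v
      have : (2 * k + 1) / 2 = k := by omega
      simp only [scaledInd, hk, this, rt2_pow]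
    · refine Submodule.subset_span
        (Or.inl ⟨_, Submodule.subset_span ⟨_, W, a, hW, rfl, rfl⟩, ?_⟩)
      ext v
      have : (2 * k + 1 + 0) / 2 = k := by omega
      simp only [Pi.smul_apply, smul_eq_mul, scaledInd, hk, this, pow_succ]
      split_ifs
      · rw [rt2_pow, mul_comm]
      · simp

lemma scaledInd_mem {m : ℕ} (W : Submodule (ZMod 2) (V m)) (a : V m) :
    scaledInd W a ∈ balancedBW m := by
  rw [balancedBW_eq_span]
  exact Submodule.subset_span ⟨W, a, rfl⟩

/-- The identification `ℝ^{2^n} ⊗ ℝ² → ℝ^{2^{n+1}}` as a bilinear map. -/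
def tens (n : ℕ) : (V n → ℝ) →ₗ[Rsq2] (V 1 → ℝ) →ₗ[Rsq2] (V (n + 1) → ℝ) :=
  LinearMap.mk₂ Rsq2 (fun u w v => u (Fin.init v) * w (fun _ => v (Fin.last n)))
    (fun _ _ _ => by ext v; exact add_mul _ _ _)
    (fun c u w => by
      ext v; exact smul_mul_assoc c (u (Fin.init v)) (w fun _ => v (Fin.last n)))
    (fun _ _ _ => by ext v; exact mul_add _ _ _)
    (fun c u w => by
      ext v; exact mul_smul_comm c (u (Fin.init v)) (w fun _ => v (Fin.last n)))

lemma tens_apply {n : ℕ} (u : V n → ℝ) (w : V 1 → ℝ) (v : V (n + 1)) :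
    tens n u w v = u (Fin.init v) * w (fun _ => v (Fin.last n)) := rfl

/-- The identification `𝔽₂^{n+1} = 𝔽₂^n × 𝔽₂`. -/
def splitLast (n : ℕ) : V (n + 1) ≃ₗ[ZMod 2] V n × V 1 where
  toFun v := (Fin.init v, fun _ => v (Fin.last n))
  invFun p := Fin.snoc p.1 (p.2 0)
  map_add' _ _ := rfl
  map_smul' _ _ := rfl
  left_inv v := Fin.snoc_init_self v
  right_inv p := by
    refine Prod.ext (Fin.init_snoc (α := fun _ => ZMod 2) _ _) (funext fun i => ?_)
    rw [Subsingleton.elim i 0]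
    exact Fin.snoc_last (α := fun _ => ZMod 2) _ _

/-- The bilinear map `tens` sends indicators to indicators of products. -/
lemma tens_scaledInd {n : ℕ} (W : Submodule (ZMod 2) (V n)) (a : V n)
    (W' : Submodule (ZMod 2) (V 1)) (a' : V 1) :
    tens n (scaledInd W a) (scaledInd W' a') =
      scaledInd ((W.prod W').map (splitLast n).symm.toLinearMap) ((splitLast n).symm (a, a')) := by
  have hrank : Module.finrank (ZMod 2) ((W.prod W').map (splitLast n).symm.toLinearMap) =
      Module.finrank (ZMod 2) W + Module.finrank (ZMod 2) W' := by
    rw [LinearEquiv.finrank_map_eq, ← Module.finrank_prod]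
    exact LinearEquiv.finrank_eq
      { toFun := fun x => (⟨x.1.1, x.2.1⟩, ⟨x.1.2, x.2.2⟩)
        invFun := fun x => ⟨(x.1, x.2), x.1.2, x.2.2⟩
        map_add' := fun _ _ => rfl
        map_smul' := fun _ _ => rfl
        left_inv := fun _ => rfl
        right_inv := fun _ => rfl }
  have h1 := finrank_le W
  have h2 := finrank_le W'
  ext v
  have hmem : v - (splitLast n).symm (a, a') ∈ (W.prod W').map (splitLast n).symm.toLinearMap ↔
      Fin.init v - a ∈ W ∧ (fun _ => v (Fin.last n)) - a' ∈ W' := by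
    rw [Submodule.map_equiv_eq_comap_symm, Submodule.mem_comap]
    simp only [LinearEquiv.symm_symm, LinearEquiv.coe_coe, map_sub, LinearEquiv.apply_symm_apply]
    exact Iff.rfl
  have hexp : n + 1 - (Module.finrank (ZMod 2) W + Module.finrank (ZMod 2) W') =
      (n - Module.finrank (ZMod 2) W) + (1 - Module.finrank (ZMod 2) W') := by omega
  simp only [tens_apply, scaledInd, hmem, hrank, hexp, pow_add]
  split_ifs <;> simp_all

lemma mem_sup_span_singleton_zmod_two {E : Type*} [AddCommGroup E] [Module (ZMod 2) E]
    (p : Submodule (ZMod 2) E) (c x : E) :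
    x ∈ p ⊔ Submodule.span (ZMod 2) {c} ↔ x ∈ p ∨ x - c ∈ p := by
  constructor
  · intro h
    obtain ⟨y, hy, z, hz, rfl⟩ := Submodule.mem_sup.1 h
    obtain ⟨t, rfl⟩ := Submodule.mem_span_singleton.1 hz
    obtain rfl | rfl : t = 0 ∨ t = 1 := (by decide : ∀ t : ZMod 2, t = 0 ∨ t = 1) t
    · left; simpa
    · right; simpa
  · rintro (h | h)
    · exact Submodule.mem_sup_left h
    · rw [← sub_add_cancel x c]
      exact add_mem (Submodule.mem_sup_left h)
        (Submodule.mem_sup_right (Submodule.mem_span_singleton_self c))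

lemma V_one_eq (t : V 1) : t = 0 ∨ t = 1 := by
  revert t
  decide

lemma scaledInd_mem_map₂ {n : ℕ} (W : Submodule (ZMod 2) (V (n + 1))) (a : V (n + 1)) :
    scaledInd W a ∈ Submodule.map₂ (tens n) (balancedBW n) (balancedBW 1) := by
  set T := Submodule.map₂ (tens n) (balancedBW n) (balancedBW 1)
  have hT (p : Submodule (ZMod 2) (V n)) (b : V n) (q : Submodule (ZMod 2) (V 1)) (t : V 1) :
      tens n (scaledInd p b) (scaledInd q t) ∈ T :=
    Submodule.apply_mem_map₂ _ (scaledInd_mem p b) (scaledInd_mem q t)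
  obtain ⟨P, rfl⟩ : ∃ P : Submodule (ZMod 2) (V n × V 1),
      W = P.map (splitLast n).symm.toLinearMap :=
    ⟨W.map (splitLast n).toLinearMap, by
      rw [← Submodule.map_comp]; simp⟩
  obtain ⟨⟨b, t⟩, rfl⟩ := (splitLast n).symm.surjective a
  set P₀ := P.comap (LinearMap.inl (ZMod 2) (V n) (V 1))
  have hmem₀ (x : V n) : x ∈ P₀ ↔ (x, 0) ∈ P := Iff.rfl
  by_cases hc : ∃ c, (c, (1 : V 1)) ∈ P
  · obtain ⟨c, hc⟩ := hc
    have hmem₁ (x : V n) : (x, (1 : V 1)) ∈ P ↔ x - c ∈ P₀ := by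
      rw [hmem₀, ← P.sub_mem_iff_left hc]
      simp
    by_cases hc₀ : c ∈ P₀
    · have : P = P₀.prod ⊤ := by
        ext ⟨x, s⟩
        obtain rfl | rfl := V_one_eq s
        · simp [hmem₀]
        · rw [hmem₁, P₀.sub_mem_iff_left hc₀]
          simp
      rw [this, ← tens_scaledInd]
      exact hT _ _ _ _
    · have hP : P = P₀.map (LinearMap.inl (ZMod 2) (V n) (V 1)) ⊔
          Submodule.span (ZMod 2) {(c, (1 : V 1))} := by
        ext ⟨x, s⟩
        rw [mem_sup_span_singleton_zmod_two]
        obtain rfl | rfl := V_one_eq s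
        · simp [hmem₀]
        · simp [hmem₁]
      have hrank : Module.finrank (ZMod 2) (P.map (splitLast n).symm.toLinearMap) =
          Module.finrank (ZMod 2) P₀ + 1 := by
        rw [LinearEquiv.finrank_map_eq, hP, Submodule.finrank_sup_span_singleton
          (by simp),
          (P₀.equivMapOfInjective (LinearMap.inl (ZMod 2) (V n) (V 1))
            LinearMap.inl_injective).finrank_eq]
      have hrank' := Submodule.finrank_sup_span_singleton hc₀
      have hle := finrank_le (P₀ ⊔ Submodule.span (ZMod 2) {c})
      obtain ⟨k, hk⟩ : ∃ k, n = Module.finrank (ZMod 2) P₀ + 1 + k :=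
        Nat.exists_eq_add_of_le (hrank' ▸ hle)
      have key : scaledInd (P.map (splitLast n).symm.toLinearMap) ((splitLast n).symm (b, t)) =
          tens n (scaledInd P₀ b) (scaledInd ⊤ t) +
          tens n (scaledInd (P₀ ⊔ Submodule.span (ZMod 2) {c}) b) (scaledInd ⊥ (t + 1)) -
          rt2 • tens n (scaledInd P₀ b) (scaledInd ⊥ (t + 1)) := by
        ext v
        obtain ⟨⟨x, s⟩, rfl⟩ := (splitLast n).symm.surjective v
        have hmem : (splitLast n).symm (x, s) - (splitLast n).symm (b, t) ∈
            P.map (splitLast n).symm.toLinearMap ↔ (x - b, s - t) ∈ P := by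
          rw [← map_sub, Submodule.map_equiv_eq_comap_symm]
          simp
        have hinit : Fin.init ((splitLast n).symm (x, s)) = x :=
          congrArg Prod.fst ((splitLast n).apply_symm_apply (x, s))
        have hlast : (fun _ => (splitLast n).symm (x, s) (Fin.last n)) = s :=
          congrArg Prod.snd ((splitLast n).apply_symm_apply (x, s))
        have e₁ : n + 1 - (Module.finrank (ZMod 2) P₀ + 1) = k + 1 := by omega
        have e₂ : n - Module.finrank (ZMod 2) P₀ = k + 1 := by omega
        have e₃ : n - (Module.finrank (ZMod 2) P₀ + 1) = k := by omega
        have htop : 1 - Module.finrank (ZMod 2) (⊤ : Submodule (ZMod 2) (V 1)) = 0 := by simp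
        have hbot : 1 - Module.finrank (ZMod 2) (⊥ : Submodule (ZMod 2) (V 1)) = 1 := by simp
        simp only [Pi.add_apply, Pi.sub_apply, rt2_smul_apply, tens_apply,
          hinit, hlast]
        simp only [scaledInd, hrank, hrank', e₁, e₂, e₃, htop, hbot,
          Submodule.mem_top, Submodule.mem_bot, if_true]
        rw [hmem, mem_sup_span_singleton_zmod_two]
        obtain ⟨r, rfl⟩ : ∃ r, s = t + r := ⟨s - t, by abel⟩
        rw [add_sub_cancel_left, add_sub_add_left_eq_sub]
        obtain rfl | rfl := V_one_eq r
        · rw [← hmem₀]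
          simp
        · have hdisj : x - b ∈ P₀ → x - b - c ∉ P₀ := fun h h' =>
            hc₀ ((P₀.sub_mem_iff_right h).1 h')
          rw [hmem₁]
          by_cases h : x - b ∈ P₀
          · simp only [h, hdisj h, if_true, if_false, true_or, sub_self]
            linear_combination (Real.sqrt 2 ^ (k + 1)) * sqrt_two_mul_self
          · by_cases h' : x - b - c ∈ P₀ <;> simp [h, h', pow_succ]
      rw [key]
      exact T.sub_mem (T.add_mem (hT _ _ _ _) (hT _ _ _ _)) (T.smul_mem _ (hT _ _ _ _))
  · have : P = P₀.prod ⊥ := by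
      ext ⟨x, s⟩
      obtain rfl | rfl := V_one_eq s
      · simp [hmem₀]
      · simpa using fun h => hc ⟨x, h⟩
    rw [this, ← tens_scaledInd]
    exact hT _ _ _ _

/-- `M_{n+1} = M_n ⊗ M_1`. -/
lemma balancedBW_succ (n : ℕ) :
    balancedBW (n + 1) = Submodule.map₂ (tens n) (balancedBW n) (balancedBW 1) := by
  apply le_antisymm
  · rw [balancedBW_eq_span]
    refine Submodule.span_le.2 ?_
    rintro _ ⟨W, a, rfl⟩
    exact scaledInd_mem_map₂ W a
  · rw [balancedBW_eq_span n, balancedBW_eq_span 1, Submodule.map₂_span_span, Submodule.span_le]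
    rintro _ ⟨_, ⟨W, a, rfl⟩, _, ⟨W', a', rfl⟩, rfl⟩
    change tens n (scaledInd W a) (scaledInd W' a') ∈ _
    rw [tens_scaledInd]
    exact scaledInd_mem _ _

/-- `M_{n+1}` is spanned by pure tensors of vectors in `M_1`. -/
lemma balancedBW_eq_span_prod (n : ℕ) :
    balancedBW (n + 1) = Submodule.span Rsq2 {x : V (n + 1) → ℝ |
      ∃ w : Fin (n + 1) → (V 1 → ℝ), (∀ i, w i ∈ balancedBW 1) ∧
        x = fun v => ∏ i : Fin (n + 1), w i (fun _ => v i)} := by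
  induction n with
  | zero =>
    conv_lhs => rw [← Submodule.span_eq (balancedBW (0 + 1))]
    congr 1
    ext x
    have hv (v : V 1) : (fun _ => v 0) = v := funext fun i => by rw [Subsingleton.elim i 0]
    constructor
    · exact fun hx => ⟨fun _ => x, fun _ => hx, by ext v; simp [hv]⟩
    · rintro ⟨w, hw, rfl⟩
      simpa [hv] using hw 0
  | succ n ih =>
    rw [balancedBW_succ, ih, ← Submodule.span_eq (balancedBW 1), Submodule.map₂_span_span,
      Submodule.span_eq]
    congr 1
    ext x
    constructor
    · rintro ⟨_, ⟨w, hw, rfl⟩, z, hz, rfl⟩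
      refine ⟨Fin.snoc w z, fun i => ?_, ?_⟩
      · induction i using Fin.lastCases with
        | last => simpa using hz
        | cast i => simpa using hw i
      · ext v
        rw [Fin.prod_univ_castSucc]
        simp [tens_apply, Fin.init]
    · rintro ⟨w, hw, rfl⟩
      refine ⟨_, ⟨fun i => w i.castSucc, fun i => hw _, rfl⟩, w (Fin.last _), hw _, ?_⟩
      ext v
      rw [Fin.prod_univ_castSucc]
      rfl

/-- for `m = n + 1 > 1`, the balanced Barnes-Wall lattice is a tensor product:
`M_m = M_{m-1} ⊗_{ℤ[√2]} M_1` under the identification `ℝ^{2^m} = ℝ^{2^{m-1}} ⊗ ℝ²`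
(compatible with `𝔽₂^m = 𝔽₂^{m-1} × 𝔽₂`), i.e. `M_m` is the `ℤ[√2]`-span of the elementary
tensors `u ⊗ w` with `u ∈ M_{m-1}`, `w ∈ M_1`; consequently `M_m` is the `ℤ[√2]`-span of
the elementary tensors `v_1 ⊗ ⋯ ⊗ v_m` with all `v_i ∈ M_1`. -/
theorem balancedBW_tensor (n : ℕ) (hn : 1 ≤ n) :
    balancedBW (n + 1) =
      Submodule.span Rsq2 {x : V (n + 1) → ℝ |
        ∃ u ∈ balancedBW n, ∃ w ∈ balancedBW 1,
          x = fun v => u (Fin.init v) * w (fun _ => v (Fin.last n))}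
    ∧ balancedBW (n + 1) =
      Submodule.span Rsq2 {x : V (n + 1) → ℝ |
        ∃ w : Fin (n + 1) → (V 1 → ℝ), (∀ i, w i ∈ balancedBW 1) ∧
          x = fun v => ∏ i : Fin (n + 1), w i (fun _ => v i)} := by
  refine ⟨?_, balancedBW_eq_span_prod n⟩
  rw [balancedBW_succ, Submodule.map₂_eq_span_image2]
  congr 1
  ext x
  exact ⟨fun ⟨u, hu, w, hw, h⟩ => ⟨u, hu, w, hw, h.symm⟩,
    fun ⟨u, hu, w, hw, h⟩ => ⟨u, hu, w, hw, h.symm⟩⟩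

end
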